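/- arXiv:1705.01797 — 2 statements merged into one kernel-verified Lean document; each statement's English description precedes it below -/
import Mathlib

section
/- Let {x^k} be a sequence in Ω converging to a point x* with ‖∇_Ω f(x^k)‖ → 0, and assume the LICQ holds at x*: the vectors {q} ∪ {e_i : i ∈ A(x*)} are linearly independent. Let λ_i*, i ∈ A(x*), be the (unique) Lagrange multipliers of x* and A_N* = {i ∈ A(x*) : λ_i* ≠ 0}. Then for all sufficiently large k, A_N* ∩ A_l(x*) ⊆ A_l(x^k) and A_N* ∩ A_u(x*) ⊆ A_u(x^k). -/
noncomputable section

open Matrix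
open scoped Classical

/-- Euclidean dot product. -/
def dotp {m : Type*} [Fintype m] (v w : m → ℝ) : ℝ := ∑ i, v i * w i

/-- Euclidean norm. -/
def nrm {m : Type*} [Fintype m] (v : m → ℝ) : ℝ := Real.sqrt (∑ i, (v i) ^ 2)

/-- Objective f(x) = ½ xᵀHx − cᵀx. -/
def fObj {n : ℕ} (H : Matrix (Fin n) (Fin n) ℝ) (c x : Fin n → ℝ) : ℝ :=
  (1 / 2) * dotp x (H.mulVec x) - dotp c x

/-- Gradient ∇f(x) = Hx − c (for H symmetric). -/
def grad {n : ℕ} (H : Matrix (Fin n) (Fin n) ℝ) (c x : Fin n → ℝ) : Fin n → ℝ :=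
  H.mulVec x - c

/-- Feasible set Ω = {x : qᵀx = b, l ≤ x ≤ u}. -/
def OmegaSet {n : ℕ} (q : Fin n → ℝ) (b : ℝ) (l u : Fin n → ℝ) : Set (Fin n → ℝ) :=
  {x | dotp q x = b ∧ ∀ i, l i ≤ x i ∧ x i ≤ u i}

/-- Lower active set A_l(x). -/
def Al {n : ℕ} (l x : Fin n → ℝ) : Set (Fin n) := {i | x i = l i}

/-- Upper active set A_u(x). -/
def Au {n : ℕ} (u x : Fin n → ℝ) : Set (Fin n) := {i | x i = u i}

/-- Active set A(x). -/
def ASet {n : ℕ} (l u x : Fin n → ℝ) : Set (Fin n) := Al l x ∪ Au u x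

/-- Free set F(x). -/
def FSet {n : ℕ} (l u x : Fin n → ℝ) : Set (Fin n) := (ASet l u x)ᶜ

/-- ρ(x) = q_Fᵀ(∇f(x))_F / q_Fᵀq_F (0 if q_F = 0). -/
def rhoF {n : ℕ} (H : Matrix (Fin n) (Fin n) ℝ) (c q l u x : Fin n → ℝ) : ℝ :=
  if ∀ i ∈ FSet l u x, q i = 0 then 0
  else (∑ i, if i ∈ FSet l u x then q i * grad H c x i else 0) /
    (∑ i, if i ∈ FSet l u x then q i * q i else 0)

/-- h(x) = ∇f(x) − ρ(x) q. -/
def hVec {n : ℕ} (H : Matrix (Fin n) (Fin n) ℝ) (c q l u x : Fin n → ℝ) : Fin n → ℝ :=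
  fun i => grad H c x i - rhoF H c q l u x * q i

/-- Free gradient φ(x). -/
def phiVec {n : ℕ} (H : Matrix (Fin n) (Fin n) ℝ) (c q l u x : Fin n → ℝ) : Fin n → ℝ :=
  fun i => if i ∈ FSet l u x then hVec H c q l u x i else 0

/-- Tangent cone T_Ω(x). -/
def TCone {n : ℕ} (q l u x : Fin n → ℝ) : Set (Fin n → ℝ) :=
  {v | dotp q v = 0 ∧ (∀ i ∈ Al l x, 0 ≤ v i) ∧ (∀ i ∈ Au u x, v i ≤ 0)}

/-- g is the projected gradient ∇_Ω f(x): the minimizer of ‖v + ∇f(x)‖ over v ∈ T_Ω(x). -/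
def IsProjGrad {n : ℕ} (H : Matrix (Fin n) (Fin n) ℝ) (c q l u x g : Fin n → ℝ) : Prop :=
  g ∈ TCone q l u x ∧ ∀ v ∈ TCone q l u x, nrm (g + grad H c x) ≤ nrm (v + grad H c x)

/-- Chopped gradient β(x) = −∇_Ω f(x) − φ(x), where g = ∇_Ω f(x). -/
def betaVec {n : ℕ} (H : Matrix (Fin n) (Fin n) ℝ) (c q l u x g : Fin n → ℝ) : Fin n → ℝ :=
  -g - phiVec H c q l u x

/-- Binding set B(x). -/
def BSet {n : ℕ} (H : Matrix (Fin n) (Fin n) ℝ) (c q l u x : Fin n → ℝ) : Set (Fin n) :=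
  {i | (i ∈ Al l x ∧ 0 ≤ hVec H c q l u x i) ∨ (i ∈ Au u x ∧ hVec H c q l u x i ≤ 0)}

/-- Affine closure Ω(x) of the face determined by the active set at x. -/
def OmegaFace {n : ℕ} (q : Fin n → ℝ) (b : ℝ) (l u x : Fin n → ℝ) : Set (Fin n → ℝ) :=
  {v | dotp q v = b ∧ ∀ i ∈ ASet l u x, v i = x i}

/-- Ω₀(x). -/
def Omega0 {n : ℕ} (q l u x : Fin n → ℝ) : Set (Fin n → ℝ) :=
  {v | dotp q v = 0 ∧ ∀ i ∈ ASet l u x, v i = 0}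

/-- KKT stationarity: ∇f(x) = Σ_{i∈A(x)} λᵢ eᵢ + ρ q with sign conditions. -/
def Stationary {n : ℕ} (H : Matrix (Fin n) (Fin n) ℝ) (c q : Fin n → ℝ) (b : ℝ)
    (l u x : Fin n → ℝ) : Prop :=
  x ∈ OmegaSet q b l u ∧
    ∃ (ρs : ℝ) (lam : Fin n → ℝ),
      (∀ i, grad H c x i = lam i + ρs * q i) ∧
      (∀ i ∈ FSet l u x, lam i = 0) ∧
      (∀ i ∈ Al l x, 0 ≤ lam i) ∧ (∀ i ∈ Au u x, lam i ≤ 0)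

/-- Lagrange multiplier estimate λ(x). -/
def lamEst {n : ℕ} (H : Matrix (Fin n) (Fin n) ℝ) (c q l u x : Fin n → ℝ) : Fin n → ℝ :=
  fun i =>
    if i ∈ Al l x then max 0 (hVec H c q l u x i)
    else if i ∈ Au u x then min 0 (hVec H c q l u x i) else 0

/-- ζ is the smallest eigenvalue of M. -/
def IsSmallestEigenvalue {m : Type*} [Fintype m] (M : Matrix m m ℝ) (ζ : ℝ) : Prop :=
  (∃ v : m → ℝ, v ≠ 0 ∧ M.mulVec v = ζ • v) ∧
    ∀ (μ : ℝ) (v : m → ℝ), v ≠ 0 → M.mulVec v = μ • v → ζ ≤ μ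

/-- ζ is the largest eigenvalue of M. -/
def IsLargestEigenvalue {m : Type*} [Fintype m] (M : Matrix m m ℝ) (ζ : ℝ) : Prop :=
  (∃ v : m → ℝ, v ≠ 0 ∧ M.mulVec v = ζ • v) ∧
    ∀ (μ : ℝ) (v : m → ℝ), v ≠ 0 → M.mulVec v = μ • v → μ ≤ ζ

/-- t is the spectral (ℓ₂ operator) norm of M. -/
def IsSpectralNorm {m k : Type*} [Fintype m] [Fintype k] (M : Matrix m k ℝ) (t : ℝ) : Prop :=
  IsLeast {s : ℝ | 0 ≤ s ∧ ∀ v : k → ℝ, nrm (M.mulVec v) ≤ s * nrm v} t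

theorem dotp_eq_dotProduct {m : Type*} [Fintype m] (v w : m → ℝ) : dotp v w = v ⬝ᵥ w := rfl

theorem abs_apply_le_nrm {m : Type*} [Fintype m] (v : m → ℝ) (i : m) : |v i| ≤ nrm v :=
  Real.abs_le_sqrt <| Finset.single_le_sum (f := fun j => v j ^ 2)
    (fun j _ => sq_nonneg (v j)) (Finset.mem_univ i)

theorem continuous_grad {n : ℕ} (H : Matrix (Fin n) (Fin n) ℝ) (c : Fin n → ℝ) :
    Continuous (grad H c) :=
  (continuous_const.matrix_mulVec continuous_id).sub continuous_const

/-- A vector whose norm cannot be decreased by moving along `d` makes an acute angle with `d`. -/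
theorem dotp_nonneg_of_forall_nrm_le {m : Type*} [Fintype m] {w d : m → ℝ}
    (h : ∀ t : ℝ, 0 < t → nrm w ≤ nrm (w + t • d)) : 0 ≤ dotp w d := by
  have expand : ∀ t : ℝ, 0 < t → 0 ≤ 2 * dotp w d + t * dotp d d := by
    intro t ht
    have hle := (Real.sqrt_le_sqrt_iff (Finset.sum_nonneg fun i _ => sq_nonneg _)).1 (h t ht)
    have heq : ∑ i, ((w + t • d) i) ^ 2
        = ∑ i, (w i) ^ 2 + t * (2 * dotp w d + t * dotp d d) := by
      simp only [dotp, Finset.mul_sum, ← Finset.sum_add_distrib]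
      refine Finset.sum_congr rfl fun i _ => ?_
      simp only [Pi.add_apply, Pi.smul_apply, smul_eq_mul]
      ring
    exact nonneg_of_mul_nonneg_right (by linarith) ht
  have hlim : Filter.Tendsto (fun t : ℝ => 2 * dotp w d + t * dotp d d)
      (nhdsWithin 0 (Set.Ioi 0)) (nhds (2 * dotp w d + 0 * dotp d d)) :=
    Filter.Tendsto.mono_left (Continuous.tendsto (by fun_prop) 0) nhdsWithin_le_nhds
  have := ge_of_tendsto hlim (eventually_mem_nhdsWithin.mono expand)
  linarith

theorem TCone.add_smul_mem {n : ℕ} {q l u x g d : Fin n → ℝ} (hg : g ∈ TCone q l u x)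
    (hd : d ∈ TCone q l u x) {t : ℝ} (ht : 0 ≤ t) : g + t • d ∈ TCone q l u x := by
  obtain ⟨hgq, hgl, hgu⟩ := hg
  obtain ⟨hdq, hdl, hdu⟩ := hd
  rw [dotp_eq_dotProduct] at hgq hdq
  refine ⟨by simp [dotp_eq_dotProduct, hgq, hdq], fun i hi => ?_, fun i hi => ?_⟩
  · exact add_nonneg (hgl i hi) (mul_nonneg ht (hdl i hi))
  · exact add_nonpos (hgu i hi) (mul_nonpos_of_nonneg_of_nonpos ht (hdu i hi))

theorem IsProjGrad.dotp_nonneg {n : ℕ} {H : Matrix (Fin n) (Fin n) ℝ}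
    {c q l u x g d : Fin n → ℝ} (hg : IsProjGrad H c q l u x g) (hd : d ∈ TCone q l u x) :
    0 ≤ dotp (g + grad H c x) d := by
  refine dotp_nonneg_of_forall_nrm_le fun t ht => ?_
  rw [add_right_comm]
  exact hg.2 _ (TCone.add_smul_mem hg.1 hd ht.le)

/-- A descent direction at the limit is eventually not tangent, if the projected gradients
vanish. -/
theorem eventually_notMem_TCone {n : ℕ} {H : Matrix (Fin n) (Fin n) ℝ}
    {c q l u xs d : Fin n → ℝ} {xk gP : ℕ → Fin n → ℝ}
    (hconv : Filter.Tendsto xk Filter.atTop (nhds xs))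
    (hgP : ∀ k, IsProjGrad H c q l u (xk k) (gP k))
    (hgconv : Filter.Tendsto (fun k => nrm (gP k)) Filter.atTop (nhds 0))
    (hd : dotp (grad H c xs) d < 0) : ∀ᶠ k in Filter.atTop, d ∉ TCone q l u (xk k) := by
  have hg : Filter.Tendsto gP Filter.atTop (nhds 0) :=
    tendsto_pi_nhds.2 fun i =>
      squeeze_zero_norm (fun k => abs_apply_le_nrm (gP k) i) hgconv
  have hsum := hg.add (((continuous_grad H c).tendsto xs).comp hconv)
  have hdot : Continuous fun w : Fin n → ℝ => dotp w d := by
    unfold dotp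
    fun_prop
  have hlim := (hdot.tendsto _).comp hsum
  rw [zero_add] at hlim
  filter_upwards [hlim.eventually_lt_const hd] with k hk hmem
  exact hk.not_ge ((hgP k).dotp_nonneg hmem)

/-- Under LICQ, `q` does not vanish on the free variables. -/
theorem exists_mem_FSet_ne_zero {n : ℕ} {q l u xs : Fin n → ℝ}
    (hLICQ : ∀ (a : ℝ) (μ : Fin n → ℝ),
      (∀ i ∈ FSet l u xs, μ i = 0) → a • q + μ = 0 → a = 0 ∧ μ = 0) :
    ∃ j ∈ FSet l u xs, q j ≠ 0 := by
  by_contra! h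
  exact one_ne_zero (hLICQ 1 (-q) (fun i hi => by simp [h i hi]) (by simp)).1

theorem eventually_mem_FSet {n : ℕ} {l u xs : Fin n → ℝ} {xk : ℕ → Fin n → ℝ} {j : Fin n}
    (hconv : Filter.Tendsto xk Filter.atTop (nhds xs)) (hj : j ∈ FSet l u xs) :
    ∀ᶠ k in Filter.atTop, j ∈ FSet l u (xk k) := by
  have hcoord := tendsto_pi_nhds.1 hconv j
  have hj' : xs j ≠ l j ∧ xs j ≠ u j := not_or.1 hj
  filter_upwards [hcoord.eventually_ne hj'.1, hcoord.eventually_ne hj'.2] with k hl hu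
  exact not_or.2 ⟨hl, hu⟩

/-- The direction moving the coordinate `i` by `s`, compensated in the free coordinate `j`, is
tangent unless a bound on coordinate `i` blocks it. -/
theorem single_sub_single_mem_TCone {n : ℕ} {q l u x : Fin n → ℝ} {i j : Fin n} {s : ℝ}
    (hj : j ∈ FSet l u x) (hqj : q j ≠ 0) (hl : i ∈ Al l x → 0 ≤ s) (hu : i ∈ Au u x → s ≤ 0) :
    Pi.single i s - Pi.single j (s * q i / q j) ∈ TCone q l u x := by
  have hj' : j ∉ Al l x ∧ j ∉ Au u x := not_or.1 hj
  refine ⟨?_, fun m hm => ?_, fun m hm => ?_⟩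
  · simp only [dotp_eq_dotProduct, dotProduct_sub, dotProduct_single]
    field_simp
    ring
  · have hmj : m ≠ j := fun h => hj'.1 (h ▸ hm)
    rcases eq_or_ne m i with rfl | hmi
    · simpa [hmj] using hl hm
    · simp [hmj, hmi]
  · have hmj : m ≠ j := fun h => hj'.2 (h ▸ hm)
    rcases eq_or_ne m i with rfl | hmi
    · simpa [hmj] using hu hm
    · simp [hmj, hmi]

/-- identification of nondegenerate active constraints under LICQ. -/
theorem stmt_3 {n : ℕ} (hn : 1 ≤ n)
    (H : Matrix (Fin n) (Fin n) ℝ) (hH : H.IsSymm)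
    (c q l u : Fin n → ℝ) (b : ℝ) (hlu : ∀ i, l i < u i)
    (xk : ℕ → Fin n → ℝ) (hxk : ∀ k, xk k ∈ OmegaSet q b l u)
    (xs : Fin n → ℝ) (hxs : xs ∈ OmegaSet q b l u)
    (hconv : Filter.Tendsto xk Filter.atTop (nhds xs))
    (gP : ℕ → Fin n → ℝ)
    (hgP : ∀ k, IsProjGrad H c q l u (xk k) (gP k))
    (hgconv : Filter.Tendsto (fun k => nrm (gP k)) Filter.atTop (nhds 0))
    -- LICQ: {q} ∪ {e_i : i ∈ A(x*)} linearly independent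
    (hLICQ : ∀ (a : ℝ) (μ : Fin n → ℝ),
        (∀ i ∈ FSet l u xs, μ i = 0) → a • q + μ = 0 → a = 0 ∧ μ = 0)
    -- the (unique) Lagrange multipliers of the stationary point x*
    (ρs : ℝ) (lam : Fin n → ℝ)
    (hkkt : ∀ i, grad H c xs i = lam i + ρs * q i)
    (hsupp : ∀ i ∈ FSet l u xs, lam i = 0)
    (hsl : ∀ i ∈ Al l xs, 0 ≤ lam i)
    (hsu : ∀ i ∈ Au u xs, lam i ≤ 0) :
    -- A_N* ∩ A_l(x*) ⊆ A_l(x^k) and A_N* ∩ A_u(x*) ⊆ A_u(x^k) for k large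
    ∃ K, ∀ k ≥ K, ∀ i ∈ ASet l u xs, lam i ≠ 0 →
      (i ∈ Al l xs → i ∈ Al l (xk k)) ∧ (i ∈ Au u xs → i ∈ Au u (xk k)) := by
  obtain ⟨j, hj, hqj⟩ := exists_mem_FSet_ne_zero hLICQ
  have slope : ∀ (i : Fin n) (s : ℝ),
      dotp (grad H c xs) (Pi.single i s - Pi.single j (s * q i / q j)) = lam i * s := by
    intro i s
    simp only [dotp_eq_dotProduct, dotProduct_sub, dotProduct_single, hkkt, hsupp j hj]
    field_simp
    ring
  have blocked : ∀ (i : Fin n) (s : ℝ), lam i * s < 0 → ∀ᶠ k in Filter.atTop,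
      ¬ ((i ∈ Al l (xk k) → 0 ≤ s) ∧ (i ∈ Au u (xk k) → s ≤ 0)) := by
    intro i s hs
    filter_upwards [eventually_mem_FSet hconv hj,
      eventually_notMem_TCone hconv hgP hgconv ((slope i s).trans_lt hs)] with k hjk hk hi
    exact hk (single_sub_single_mem_TCone hjk hqj hi.1 hi.2)
  rw [← Filter.eventually_atTop, Filter.eventually_all]
  intro i
  by_cases hlam : lam i = 0
  · exact Filter.Eventually.of_forall fun k _ h => absurd hlam h
  have lower : i ∈ Al l xs → ∀ᶠ k in Filter.atTop, i ∈ Al l (xk k) := by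
    intro hi
    have hpos := lt_of_le_of_ne (hsl i hi) (Ne.symm hlam)
    filter_upwards [blocked i (-1) (by linarith)] with k hk
    by_contra hik
    exact hk ⟨fun h => absurd h hik, fun _ => by norm_num⟩
  have upper : i ∈ Au u xs → ∀ᶠ k in Filter.atTop, i ∈ Au u (xk k) := by
    intro hi
    have hneg := lt_of_le_of_ne (hsu i hi) hlam
    filter_upwards [blocked i 1 (by linarith)] with k hk
    by_contra hik
    exact hk ⟨fun _ => by norm_num, fun h => absurd h hik⟩
  filter_upwards [Filter.eventually_imp_distrib_left.2 lower,
    Filter.eventually_imp_distrib_left.2 upper] with k hl hu _ _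
  exact ⟨hl, hu⟩
end
end

section
/- For any x ∈ Ω, ‖β(x)‖² = ∇f(x)ᵀβ(x). -/
noncomputable section

open Matrix
open scoped Classical

theorem nrm_sq {m : Type*} [Fintype m] (v : m → ℝ) : nrm v ^ 2 = v ⬝ᵥ v := by
  unfold nrm
  rw [Real.sq_sqrt (Finset.sum_nonneg fun i _ => sq_nonneg _)]
  simp [dotProduct, sq]

theorem nrm_nonneg {m : Type*} [Fintype m] (v : m → ℝ) : 0 ≤ nrm v := Real.sqrt_nonneg _

theorem phiVec_eq_zero_of_mem_Al {n : ℕ} (H : Matrix (Fin n) (Fin n) ℝ) (c q l u x : Fin n → ℝ)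
    {i : Fin n} (hi : i ∈ Al l x) : phiVec H c q l u x i = 0 :=
  if_neg fun h => h (Or.inl hi)

theorem phiVec_eq_zero_of_mem_Au {n : ℕ} (H : Matrix (Fin n) (Fin n) ℝ) (c q l u x : Fin n → ℝ)
    {i : Fin n} (hi : i ∈ Au u x) : phiVec H c q l u x i = 0 :=
  if_neg fun h => h (Or.inr hi)

/-- The free gradient is orthogonal to the constraint normal. -/
theorem dotProduct_phiVec_eq_zero {n : ℕ} (H : Matrix (Fin n) (Fin n) ℝ)
    (c q l u x : Fin n → ℝ) : q ⬝ᵥ phiVec H c q l u x = 0 := by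
  by_cases hq : ∀ i ∈ FSet l u x, q i = 0
  · refine Finset.sum_eq_zero fun i _ => ?_
    by_cases hi : i ∈ FSet l u x
    · simp [hq i hi]
    · simp [phiVec, hi]
  · have hD : (∑ i, if i ∈ FSet l u x then q i * q i else 0) ≠ 0 := by
      push Not at hq
      obtain ⟨j, hj, hqj⟩ := hq
      refine (Finset.sum_pos' (fun i _ => ?_) ⟨j, Finset.mem_univ j, ?_⟩).ne'
      · split_ifs
        exacts [mul_self_nonneg _, le_rfl]
      · rw [if_pos hj]
        exact mul_self_pos.2 hqj
    have hρ : rhoF H c q l u x * (∑ i, if i ∈ FSet l u x then q i * q i else 0) =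
        ∑ i, if i ∈ FSet l u x then q i * grad H c x i else 0 := by
      rw [rhoF, if_neg hq, div_mul_cancel₀ _ hD]
    calc q ⬝ᵥ phiVec H c q l u x
        = (∑ i, if i ∈ FSet l u x then q i * grad H c x i else 0) -
          rhoF H c q l u x * (∑ i, if i ∈ FSet l u x then q i * q i else 0) := by
          rw [Finset.mul_sum, ← Finset.sum_sub_distrib]
          refine Finset.sum_congr rfl fun i _ => ?_
          simp only [phiVec, hVec]
          split_ifs <;> ring
      _ = 0 := by rw [hρ, sub_self]

theorem grad_dotProduct_phiVec {n : ℕ} (H : Matrix (Fin n) (Fin n) ℝ) (c q l u x : Fin n → ℝ) :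
    grad H c x ⬝ᵥ phiVec H c q l u x = phiVec H c q l u x ⬝ᵥ phiVec H c q l u x := by
  have h : grad H c x ⬝ᵥ phiVec H c q l u x = phiVec H c q l u x ⬝ᵥ phiVec H c q l u x +
      rhoF H c q l u x * (q ⬝ᵥ phiVec H c q l u x) := by
    simp only [dotProduct, Finset.mul_sum, ← Finset.sum_add_distrib]
    refine Finset.sum_congr rfl fun i _ => ?_
    simp only [phiVec, hVec]
    split_ifs <;> ring
  rw [h, dotProduct_phiVec_eq_zero, mul_zero, add_zero]

/-- The residual of the projection is orthogonal to every direction along which one can move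
both ways inside the tangent cone. -/
theorem IsProjGrad.dotProduct_eq_zero {n : ℕ} {H : Matrix (Fin n) (Fin n) ℝ}
    {c q l u x g d : Fin n → ℝ} (hg : IsProjGrad H c q l u x g)
    (hd : ∀ t : ℝ, |t| ≤ 1 → g + t • d ∈ TCone q l u x) : (g + grad H c x) ⬝ᵥ d = 0 := by
  set r := g + grad H c x with hr
  have hD : 0 ≤ d ⬝ᵥ d := Finset.sum_nonneg fun i _ => mul_self_nonneg _
  have key : ∀ t : ℝ, |t| ≤ 1 → 0 ≤ 2 * t * (r ⬝ᵥ d) + t ^ 2 * (d ⬝ᵥ d) := by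
    intro t ht
    have h := pow_le_pow_left₀ (nrm_nonneg _) (hg.2 _ (hd t ht)) 2
    rw [show g + t • d + grad H c x = r + t • d by rw [hr]; abel, ← hr, nrm_sq, nrm_sq] at h
    simp only [add_dotProduct, dotProduct_add, smul_dotProduct, dotProduct_smul, smul_eq_mul,
      dotProduct_comm d r] at h
    linarith
  by_contra hs
  set s := r ⬝ᵥ d
  set K := d ⬝ᵥ d + |s| + 1
  have hK : 0 < K := by positivity
  have h := key (-s / K) (by
    rw [abs_div, abs_neg, abs_of_pos hK, div_le_one hK]
    linarith)
  have heq : 2 * (-s / K) * s + (-s / K) ^ 2 * (d ⬝ᵥ d) =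
      -(s ^ 2 * (2 * K - d ⬝ᵥ d) / K ^ 2) := by
    field_simp
    ring
  have hlt : 0 < 2 * K - d ⬝ᵥ d := by
    have := abs_nonneg s
    linarith
  have : 0 < s ^ 2 * (2 * K - d ⬝ᵥ d) / K ^ 2 := by positivity
  linarith

theorem IsProjGrad.dotProduct_self {n : ℕ} {H : Matrix (Fin n) (Fin n) ℝ}
    {c q l u x g : Fin n → ℝ} (hg : IsProjGrad H c q l u x g) :
    (g + grad H c x) ⬝ᵥ g = 0 := by
  obtain ⟨hq, hl, hu⟩ := hg.1
  rw [dotp_eq_dotProduct] at hq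
  refine hg.dotProduct_eq_zero fun t ht => ?_
  have ht' : 0 ≤ 1 + t := by linarith [(abs_le.1 ht).1]
  rw [show g + t • g = (1 + t) • g by rw [add_smul, one_smul]]
  refine ⟨?_, fun i hi => mul_nonneg ht' (hl i hi),
    fun i hi => mul_nonpos_of_nonneg_of_nonpos ht' (hu i hi)⟩
  rw [dotp_eq_dotProduct, dotProduct_smul, hq, smul_zero]

theorem IsProjGrad.dotProduct_phiVec {n : ℕ} {H : Matrix (Fin n) (Fin n) ℝ}
    {c q l u x g : Fin n → ℝ} (hg : IsProjGrad H c q l u x g) :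
    (g + grad H c x) ⬝ᵥ phiVec H c q l u x = 0 := by
  obtain ⟨hq, hl, hu⟩ := hg.1
  rw [dotp_eq_dotProduct] at hq
  refine hg.dotProduct_eq_zero fun t _ => ⟨?_, fun i hi => ?_, fun i hi => ?_⟩
  · rw [dotp_eq_dotProduct, dotProduct_add, dotProduct_smul, hq, dotProduct_phiVec_eq_zero,
      smul_zero, add_zero]
  · simpa [phiVec_eq_zero_of_mem_Al H c q l u x hi] using hl i hi
  · simpa [phiVec_eq_zero_of_mem_Au H c q l u x hi] using hu i hi

/-- ‖β(x)‖² = ∇f(x)ᵀ β(x). -/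
theorem stmt_8 {n : ℕ} (hn : 1 ≤ n)
    (H : Matrix (Fin n) (Fin n) ℝ) (hH : H.IsSymm)
    (c q l u : Fin n → ℝ) (b : ℝ) (hlu : ∀ i, l i < u i)
    (x : Fin n → ℝ) (hx : x ∈ OmegaSet q b l u)
    (gP : Fin n → ℝ) (hgP : IsProjGrad H c q l u x gP) :
    nrm (betaVec H c q l u x gP) ^ 2 = dotp (grad H c x) (betaVec H c q l u x gP) := by
  have hself := hgP.dotProduct_self
  have hphi := hgP.dotProduct_phiVec
  have hgrad := grad_dotProduct_phiVec H c q l u x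
  rw [nrm_sq, dotp_eq_dotProduct, betaVec]
  simp only [add_dotProduct, sub_dotProduct, dotProduct_sub, neg_dotProduct, dotProduct_neg,
    dotProduct_comm (phiVec H c q l u x) gP] at *
  linarith
end
end
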